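/- arXiv:1911.10032 — 3 statements merged into one kernel-verified Lean document; each statement's English description precedes it below -/
import Mathlib

section
/- For every s with 0 < s < 1 there exists a Borel set E ⊆ ℝ of Hausdorff dimension s that is mid-point convex but not convex and satisfies H^s(E) = ∞. -/
open MeasureTheory Set Filter
open scoped ENNReal

/-- Binary digit positions split into free blocks `[m k, n (k + 1))` and constrained blocks
`[n k, m k)`; `F k` counts the free positions below `n k`, and the proportion of free positions
below `m k` is asymptotically `s`. -/
structure DigitBlocks (s : ℝ) where
  F : ℕ → ℕ
  n : ℕ → ℕ
  m : ℕ → ℕ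
  F_strictMono : StrictMono F
  n_zero : n 0 = 0
  n_succ : ∀ k, n (k + 1) + F k = m k + F (k + 1)
  n_lt_m : ∀ k, n (k + 1) < m (k + 1)
  mul_m_le : ∀ k, s * m k ≤ F k
  n_le_mul_m : ∀ d : ℝ, s < d → ∀ᶠ k in atTop, (n k : ℝ) ≤ d * m k

theorem nonempty_digitBlocks {s : ℝ} (hs0 : 0 < s) (hs1 : s < 1) : Nonempty (DigitBlocks s) := by
  obtain ⟨L, hL⟩ := exists_nat_ge (s / (1 - s) + 1)
  have h1s : 0 < 1 - s := by linarith
  have hL1 : (1 : ℝ) ≤ L := by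
    have : 0 ≤ s / (1 - s) := by positivity
    linarith
  have hLs : s ≤ L * (1 - s) := by
    rw [← div_le_iff₀ h1s]; linarith
  have hLpos : 0 < L := by exact_mod_cast (zero_lt_one.trans_le hL1)
  let F : ℕ → ℕ := fun k => L * (k + 1).factorial
  let m : ℕ → ℕ := fun k => ⌊(F k : ℝ) / s⌋₊
  have hFs : ∀ k, F (k + 1) = (k + 2) * F k := fun k => by
    simp only [F, Nat.factorial_succ (k + 1)]; ring
  have hFL : ∀ k, L ≤ F k := fun k => Nat.le_mul_of_pos_right _ (Nat.factorial_pos _)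
  have hFk : ∀ k, k + 1 ≤ F k := fun k =>
    (Nat.self_le_factorial _).trans (Nat.le_mul_of_pos_left _ hLpos)
  have hFmono : StrictMono F := strictMono_nat_of_lt_succ fun k => by
    rw [hFs]; nlinarith [hFk k]
  have hmle : ∀ k, (m k : ℝ) ≤ F k / s := fun k => Nat.floor_le (by positivity)
  have hmgt : ∀ k, (F k : ℝ) / s - 1 < m k := fun k => Nat.sub_one_lt_floor _
  let n : ℕ → ℕ := fun k => Nat.casesOn k 0 fun j => m j + (F (j + 1) - F j)
  have hn : ∀ k, n (k + 1) + F k = m k + F (k + 1) := fun k => by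
    have := (hFmono (Nat.lt_succ_self k)).le
    simp only [n]; simp only [Nat.succ_eq_add_one] at this; omega
  have hnR : ∀ k, (n (k + 1) : ℝ) + F k = m k + F (k + 1) := fun k => by exact_mod_cast hn k
  have hFsR : ∀ k, (F (k + 1) : ℝ) = (k + 2) * F k := fun k => by exact_mod_cast hFs k
  have hFLR : ∀ k, (L : ℝ) ≤ F k := fun k => by exact_mod_cast hFL k
  have hFkR : ∀ k : ℕ, (k : ℝ) + 1 ≤ F k := fun k => by exact_mod_cast hFk k
  refine ⟨⟨F, n, m, hFmono, rfl, hn, fun k => ?_, fun k => ?_, fun d hd => ?_⟩⟩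
  · have h1 := hmle k
    have h2 := hmgt (k + 1)
    have h3 := hnR k
    have h4 : (F (k + 1) : ℝ) / s - F k / s - (F (k + 1) - F k) ≥ 1 := by
      have : (F (k + 1) : ℝ) / s - F k / s - (F (k + 1) - F k)
          = ((F (k + 1) : ℝ) - F k) * (1 - s) / s := by field_simp
      rw [this, ge_iff_le, le_div_iff₀ hs0, hFsR]
      have h5 : (L : ℝ) ≤ (k + 2) * F k - F k := by
        nlinarith [hFLR k,
          mul_nonneg (Nat.cast_nonneg (α := ℝ) k) (Nat.cast_nonneg (α := ℝ) (F k))]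
      nlinarith
    have : (n (k + 1) : ℝ) < m (k + 1) := by linarith
    exact_mod_cast this
  · have := hmle k
    rwa [le_div_iff₀ hs0, mul_comm] at this
  · have hds : 0 < d / s - 1 := by rw [sub_pos, one_lt_div hs0]; exact hd
    obtain ⟨K, hK⟩ := exists_nat_ge (max d ((1 / s + 1) / (d / s - 1)))
    filter_upwards [eventually_ge_atTop (K + 1)] with k hk
    obtain ⟨j, rfl⟩ : ∃ j, k = j + 1 := ⟨k - 1, by omega⟩
    have hjK : (K : ℝ) ≤ j := by exact_mod_cast (by omega : K ≤ j)
    have hdj : d ≤ j := (le_max_left _ _).trans (hK.trans hjK)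
    have hj : (1 / s + 1) ≤ j * (d / s - 1) := by
      rw [← div_le_iff₀ hds]; exact (le_max_right _ _).trans (hK.trans hjK)
    have h1 := hmle j
    have h2 := hmgt (j + 1)
    have h3 := hnR j
    have h4 : d * (F (j + 1) / s - 1) ≤ d * m (j + 1) :=
      mul_le_mul_of_nonneg_left h2.le (by linarith)
    have h5 := hFkR j
    have h6 : (1 / s + 1) * F j ≤ (j + 2) * F j * (d / s - 1) := by nlinarith
    have h7 : (F j : ℝ) / s + F (j + 1) ≤ d * (F (j + 1) / s - 1) := by
      rw [hFsR]
      have e1 : (F j : ℝ) / s = 1 / s * F j := by ring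
      have e2 : d * ((j + 2) * (F j : ℝ) / s - 1) = (j + 2) * F j * (d / s) - d := by ring
      rw [e1, e2]; nlinarith
    linarith [(Nat.cast_nonneg (F j) : (0 : ℝ) ≤ F j)]

namespace DigitBlocks

variable {s : ℝ} (B : DigitBlocks s)

theorem m_lt_n_succ (k : ℕ) : B.m k < B.n (k + 1) := by
  have := B.n_succ k
  have := B.F_strictMono k.lt_succ_self
  simp only [Nat.succ_eq_add_one] at this
  omega

theorem n_le_m (k : ℕ) : B.n k ≤ B.m k := by
  cases k with
  | zero => simp [B.n_zero]
  | succ k => exact (B.n_lt_m k).le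

theorem m_strictMono : StrictMono B.m :=
  strictMono_nat_of_lt_succ fun k => (B.m_lt_n_succ k).trans (B.n_lt_m k)

/-- Bounded reals within `2 ^ C / 2 ^ m k` of a multiple of `1 / 2 ^ (n k + C)` for every `k`. -/
def layer (C : ℕ) : Set ℝ :=
  {x | |x| ≤ 2 ^ C ∧ ∀ k, ∃ p : ℤ, |x - p / 2 ^ (B.n k + C)| ≤ 2 ^ C / 2 ^ B.m k}

/-- The union of the layers, a subgroup of `ℝ` stable under halving. -/
def carrier : Set ℝ := ⋃ C, B.layer C

theorem measurableSet_layer (C : ℕ) : MeasurableSet (B.layer C) := by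
  have h : B.layer C = {x : ℝ | |x| ≤ 2 ^ C} ∩
      ⋂ k, ⋃ p : ℤ, {x : ℝ | |x - p / 2 ^ (B.n k + C)| ≤ 2 ^ C / 2 ^ B.m k} := by
    ext x
    simp [layer]
  rw [h]
  exact (measurableSet_le (by fun_prop) (by fun_prop)).inter <|
    MeasurableSet.iInter fun k => MeasurableSet.iUnion fun p =>
      measurableSet_le (by fun_prop) (by fun_prop)

theorem measurableSet_carrier : MeasurableSet B.carrier :=
  MeasurableSet.iUnion B.measurableSet_layer

theorem layer_mono : Monotone B.layer := by
  refine monotone_nat_of_le_succ fun C x ⟨hx, h⟩ => ⟨hx.trans ?_, fun k => ?_⟩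
  · gcongr <;> norm_num
  · obtain ⟨p, hp⟩ := h k
    refine ⟨2 * p, ?_⟩
    have e : ((2 * p : ℤ) : ℝ) / 2 ^ (B.n k + (C + 1)) = p / 2 ^ (B.n k + C) := by
      push_cast; field_simp; ring
    rw [e]
    refine hp.trans ?_
    gcongr <;> norm_num

theorem midpoint_mem_layer {C : ℕ} {x y : ℝ} (hx : x ∈ B.layer C) (hy : y ∈ B.layer C) :
    (x + y) / 2 ∈ B.layer (C + 1) := by
  obtain ⟨hx, hx'⟩ := hx
  obtain ⟨hy, hy'⟩ := hy
  rw [abs_le] at hx hy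
  refine ⟨?_, fun k => ?_⟩
  · have : (0 : ℝ) < 2 ^ C := by positivity
    rw [abs_le, pow_succ]; constructor <;> linarith
  · obtain ⟨p, hp⟩ := hx' k
    obtain ⟨q, hq⟩ := hy' k
    refine ⟨p + q, ?_⟩
    have e : ((p + q : ℤ) : ℝ) / 2 ^ (B.n k + (C + 1))
        = (p / 2 ^ (B.n k + C) + q / 2 ^ (B.n k + C)) / 2 := by
      push_cast; field_simp; ring
    have e' : (2 : ℝ) ^ (C + 1) / 2 ^ B.m k = 2 * (2 ^ C / 2 ^ B.m k) := by ring
    have : (0 : ℝ) < 2 ^ C / 2 ^ B.m k := by positivity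
    rw [abs_le] at hp hq
    rw [e, e', abs_le]; constructor <;> linarith

theorem two_mul_mem_layer {C : ℕ} {x : ℝ} (hx : x ∈ B.layer C) :
    2 * x ∈ B.layer (C + 1) := by
  obtain ⟨hx, h⟩ := hx
  refine ⟨?_, fun k => ?_⟩
  · rw [abs_mul, abs_two, pow_succ']; gcongr
  · obtain ⟨p, hp⟩ := h k
    refine ⟨4 * p, ?_⟩
    have e : 2 * x - ((4 * p : ℤ) : ℝ) / 2 ^ (B.n k + (C + 1))
        = 2 * (x - p / 2 ^ (B.n k + C)) := by
      push_cast; field_simp; ring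
    have e' : (2 : ℝ) ^ (C + 1) / 2 ^ B.m k = 2 * (2 ^ C / 2 ^ B.m k) := by ring
    rw [e, e', abs_mul, abs_two]; gcongr

theorem midpoint_mem_carrier {x y : ℝ} (hx : x ∈ B.carrier) (hy : y ∈ B.carrier) :
    (x + y) / 2 ∈ B.carrier := by
  obtain ⟨C, hC⟩ := mem_iUnion.1 hx
  obtain ⟨D, hD⟩ := mem_iUnion.1 hy
  exact mem_iUnion.2 ⟨_, B.midpoint_mem_layer (B.layer_mono (le_max_left C D) hC)
    (B.layer_mono (le_max_right C D) hD)⟩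

theorem hausdorffMeasure_layer_lt_top (hs0 : 0 < s) {d : ℝ} (hd : s < d) (C : ℕ) :
    μH[d] (B.layer C) < ∞ := by
  have hd0 : 0 < d := hs0.trans hd
  let P : ℕ → ℤ := fun k => 2 ^ (B.n k + 2 * C + 1)
  let t : ∀ k, (Finset.Icc (-P k) (P k)) → Set ℝ := fun k p =>
    Metric.closedBall ((p : ℤ) / 2 ^ (B.n k + C) : ℝ) (2 ^ C / 2 ^ B.m k)
  let r : ℕ → ℝ := fun k => 2 * (2 ^ C / 2 ^ B.m k)
  have hr0 : ∀ k, 0 ≤ r k := fun k => by positivity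
  have hdiam : ∀ k p, Metric.ediam (t k p) ≤ ENNReal.ofReal (r k) := fun k p => by
    simp only [t]
    rw [Real.closedBall_eq_Icc, Real.ediam_Icc]
    exact ENNReal.ofReal_le_ofReal (by simp only [r]; linarith)
  have hr : Tendsto (fun k => ENNReal.ofReal (r k)) atTop (nhds 0) := by
    rw [← ENNReal.ofReal_zero]
    refine ENNReal.tendsto_ofReal ?_
    have h := (tendsto_pow_atTop_nhds_zero_of_lt_one (r := (1 / 2 : ℝ)) (by norm_num)
      (by norm_num)).comp B.m_strictMono.tendsto_atTop
    have h' := h.const_mul (2 * 2 ^ C : ℝ)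
    rw [mul_zero] at h'
    refine h'.congr fun k => ?_
    simp only [r, Function.comp, one_div, inv_pow]; ring
  have hcover : ∀ k, B.layer C ⊆ ⋃ p, t k p := fun k x ⟨hx, h⟩ => by
    obtain ⟨p, hp⟩ := h k
    have hp' : |(p : ℝ)| ≤ P k := by
      have h1 : (2 : ℝ) ^ C / 2 ^ B.m k ≤ 2 ^ C :=
        div_le_self (by positivity) (one_le_pow₀ (by norm_num))
      have h2 : |(p : ℝ) / 2 ^ (B.n k + C)| ≤ 2 ^ (C + 1) := by
        rw [abs_le] at hp hx ⊢
        rw [pow_succ]; constructor <;> linarith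
      rw [abs_div, abs_of_pos (by positivity : (0 : ℝ) < 2 ^ (B.n k + C)),
        div_le_iff₀ (by positivity)] at h2
      refine h2.trans (le_of_eq ?_)
      simp only [P]; push_cast; ring
    refine mem_iUnion.2 ⟨⟨p, Finset.mem_Icc.2 ?_⟩, ?_⟩
    · exact abs_le.1 (by exact_mod_cast hp')
    · simpa [t, Real.dist_eq] using hp
  have hle := Measure.hausdorffMeasure_le_liminf_sum d (B.layer C) (l := atTop)
    (fun k => ENNReal.ofReal (r k)) hr t (Eventually.of_forall hdiam)
    (Eventually.of_forall hcover)
  let M : ℝ := 2 ^ (2 * C + 3) * (2 * 2 ^ C) ^ d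
  have hsum : ∀ᶠ k in atTop, ∑ p, Metric.ediam (t k p) ^ d ≤ ENNReal.ofReal M := by
    filter_upwards [B.n_le_mul_m d hd] with k hk
    calc ∑ p, Metric.ediam (t k p) ^ d
      _ ≤ ∑ p : Finset.Icc (-P k) (P k), ENNReal.ofReal (r k ^ d) := by
          refine Finset.sum_le_sum fun p _ => ?_
          rw [← ENNReal.ofReal_rpow_of_nonneg (hr0 k) hd0.le]
          exact ENNReal.rpow_le_rpow (hdiam k p) hd0.le
      _ = ENNReal.ofReal ((Finset.Icc (-P k) (P k)).card * r k ^ d) := by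
          rw [ENNReal.ofReal_mul (by positivity), ENNReal.ofReal_natCast]
          simp
      _ ≤ ENNReal.ofReal M := by
          refine ENNReal.ofReal_le_ofReal ?_
          have hP1 : 1 ≤ P k := one_le_pow₀ (by norm_num)
          have hcard : ((Finset.Icc (-P k) (P k)).card : ℝ) ≤ 2 ^ (2 * C + 3) * 2 ^ B.n k := by
            have h1 : ((Finset.Icc (-P k) (P k)).card : ℤ) = 2 * P k + 1 := by
              rw [Int.card_Icc, Int.toNat_of_nonneg (by linarith)]; ring
            have h2 : ((Finset.Icc (-P k) (P k)).card : ℤ) ≤ 4 * P k := by linarith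
            have h3 : ((Finset.Icc (-P k) (P k)).card : ℝ) ≤ 4 * P k := by exact_mod_cast h2
            refine h3.trans (le_of_eq ?_)
            simp only [P]; push_cast; ring
          have hrd : r k ^ d = (2 * 2 ^ C) ^ d * (2 : ℝ) ^ (-(d * B.m k)) := by
            have : r k = (2 * 2 ^ C) * (2 : ℝ) ^ (-(B.m k : ℝ)) := by
              rw [Real.rpow_neg (by norm_num), Real.rpow_natCast]; simp only [r]; ring
            rw [this, Real.mul_rpow (by positivity) (by positivity),
              ← Real.rpow_mul (by norm_num)]
            congr 2; ring
          have hk' : (2 : ℝ) ^ B.n k * (2 : ℝ) ^ (-(d * B.m k)) ≤ 1 := by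
            rw [← Real.rpow_natCast, ← Real.rpow_add (by norm_num)]
            exact Real.rpow_le_one_of_one_le_of_nonpos (by norm_num) (by linarith)
          rw [hrd]
          calc _ ≤ 2 ^ (2 * C + 3) * 2 ^ B.n k * ((2 * 2 ^ C) ^ d * (2 : ℝ) ^ (-(d * B.m k))) := by
                gcongr
            _ = M * (2 ^ B.n k * (2 : ℝ) ^ (-(d * B.m k))) := by simp only [M]; ring
            _ ≤ M := mul_le_of_le_one_right (by positivity) hk'
  calc μH[d] (B.layer C) ≤ _ := hle
    _ ≤ ENNReal.ofReal M := liminf_le_of_frequently_le' hsum.frequently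
    _ < ∞ := ENNReal.ofReal_lt_top

theorem dimH_carrier_le (hs0 : 0 < s) : dimH B.carrier ≤ ENNReal.ofReal s := by
  rw [carrier, dimH_iUnion]
  refine iSup_le fun C => le_of_forall_gt fun d hd => ?_
  obtain ⟨e, hse, hed⟩ := ENNReal.lt_iff_exists_nnreal_btwn.1 hd
  have hse' : s < e := by
    rwa [← ENNReal.ofReal_coe_nnreal, ENNReal.ofReal_lt_ofReal_iff_of_nonneg hs0.le] at hse
  exact (dimH_le_of_hausdorffMeasure_ne_top
    (B.hausdorffMeasure_layer_lt_top hs0 hse' C).ne).trans_lt hed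

/-- The integer formed by the first `F k` binary digits of `t`. -/
noncomputable def leadingInt (t : ℝ) (k : ℕ) : ℤ := ⌊2 ^ B.F k * t⌋

/-- The number obtained by putting the first `F k` binary digits of `t` in the free positions. -/
noncomputable def spreadPartial (t : ℝ) : ℕ → ℝ
  | 0 => 0
  | k + 1 => spreadPartial t k +
      (B.leadingInt t (k + 1) - 2 ^ (B.F (k + 1) - B.F k) * B.leadingInt t k) / 2 ^ B.n (k + 1)

/-- The number obtained by putting the binary digits of `t` in the free positions. -/
noncomputable def spread (t : ℝ) : ℝ := ⨆ k, B.spreadPartial t k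

theorem two_pow_F_succ (k : ℕ) :
    (2 : ℝ) ^ B.F (k + 1) = 2 ^ (B.F (k + 1) - B.F k) * 2 ^ B.F k := by
  rw [← pow_add, Nat.sub_add_cancel (B.F_strictMono k.lt_succ_self).le]

theorem leadingInt_succ_bounds (t : ℝ) (k : ℕ) :
    2 ^ (B.F (k + 1) - B.F k) * B.leadingInt t k ≤ B.leadingInt t (k + 1) ∧
      B.leadingInt t (k + 1) + 1 ≤ 2 ^ (B.F (k + 1) - B.F k) * (B.leadingInt t k + 1) := by
  have h1 := Int.floor_le (2 ^ B.F k * t)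
  have h2 := Int.lt_floor_add_one (2 ^ B.F k * t)
  have hpos : (0 : ℝ) < 2 ^ (B.F (k + 1) - B.F k) := by positivity
  constructor
  · rw [leadingInt, leadingInt, Int.le_floor, two_pow_F_succ, mul_assoc]
    push_cast
    gcongr
  · rw [Int.add_one_le_iff, leadingInt, leadingInt, Int.floor_lt, two_pow_F_succ, mul_assoc]
    push_cast
    gcongr

theorem spreadPartial_monotone (t : ℝ) : Monotone (B.spreadPartial t) := by
  refine monotone_nat_of_le_succ fun k => ?_
  have h : (2 : ℝ) ^ (B.F (k + 1) - B.F k) * B.leadingInt t k ≤ B.leadingInt t (k + 1) := by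
    exact_mod_cast (B.leadingInt_succ_bounds t k).1
  rw [spreadPartial, le_add_iff_nonneg_right]
  exact div_nonneg (by linarith) (by positivity)

theorem spreadPartial_add_antitone (t : ℝ) :
    Antitone fun k => B.spreadPartial t k + 1 / 2 ^ B.m k := by
  refine antitone_nat_of_succ_le fun k => ?_
  have h : (B.leadingInt t (k + 1) : ℝ) + 1 ≤
      2 ^ (B.F (k + 1) - B.F k) * (B.leadingInt t k + 1) := by
    exact_mod_cast (B.leadingInt_succ_bounds t k).2
  have hm : (1 : ℝ) / 2 ^ B.m (k + 1) ≤ 1 / 2 ^ B.n (k + 1) := by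
    gcongr
    · norm_num
    · exact B.n_le_m _
  have e : (1 : ℝ) / 2 ^ B.m k = 2 ^ (B.F (k + 1) - B.F k) / 2 ^ B.n (k + 1) := by
    have : B.n (k + 1) = B.m k + (B.F (k + 1) - B.F k) := by
      have := B.n_succ k
      have := (B.F_strictMono k.lt_succ_self).le
      simp only [Nat.succ_eq_add_one] at this
      omega
    rw [this, pow_add]; field_simp
  have key : ((B.leadingInt t (k + 1) : ℝ) - 2 ^ (B.F (k + 1) - B.F k) * B.leadingInt t k)
      / 2 ^ B.n (k + 1) + 1 / 2 ^ B.n (k + 1) ≤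
      2 ^ (B.F (k + 1) - B.F k) / 2 ^ B.n (k + 1) := by
    rw [← add_div]; gcongr; linarith
  simp only [spreadPartial]
  linarith

theorem spread_mem_Icc (t : ℝ) (k : ℕ) :
    B.spread t ∈ Icc (B.spreadPartial t k) (B.spreadPartial t k + 1 / 2 ^ B.m k) :=
  mem_iInter.1 ((B.spreadPartial_monotone t).ciSup_mem_iInter_Icc_of_antitone
    (B.spreadPartial_add_antitone t) fun _ => le_add_of_nonneg_right (by positivity)) k

theorem exists_spreadPartial_eq (t : ℝ) (k : ℕ) :
    ∃ p : ℤ, B.spreadPartial t k = p / 2 ^ B.n k := by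
  induction k with
  | zero => exact ⟨0, by simp [spreadPartial]⟩
  | succ k ih =>
    obtain ⟨p, hp⟩ := ih
    have hle : B.n k ≤ B.n (k + 1) := (B.n_le_m k).trans (B.m_lt_n_succ k).le
    refine ⟨2 ^ (B.n (k + 1) - B.n k) * p +
      (B.leadingInt t (k + 1) - 2 ^ (B.F (k + 1) - B.F k) * B.leadingInt t k), ?_⟩
    have e : (2 : ℝ) ^ B.n (k + 1) = 2 ^ (B.n (k + 1) - B.n k) * 2 ^ B.n k := by
      rw [← pow_add, Nat.sub_add_cancel hle]
    rw [spreadPartial, hp]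
    push_cast
    rw [add_div, e]
    field_simp

theorem spread_mem_layer (t : ℝ) : B.spread t ∈ B.layer 0 := by
  refine ⟨?_, fun k => ?_⟩
  · obtain ⟨h1, h2⟩ := B.spread_mem_Icc t 0
    simp only [spreadPartial, zero_add] at h1 h2
    rw [abs_of_nonneg h1, pow_zero]
    exact h2.trans (div_le_self zero_le_one (one_le_pow₀ (by norm_num)))
  · obtain ⟨p, hp⟩ := B.exists_spreadPartial_eq t k
    obtain ⟨h1, h2⟩ := B.spread_mem_Icc t k
    refine ⟨p, ?_⟩
    rw [add_zero, pow_zero, ← hp, abs_of_nonneg (by linarith)]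
    linarith

theorem spreadPartial_congr {t u : ℝ} {k : ℕ}
    (h : ∀ j ≤ k, B.leadingInt t j = B.leadingInt u j) :
    B.spreadPartial t k = B.spreadPartial u k := by
  induction k with
  | zero => rfl
  | succ k ih =>
    rw [spreadPartial, spreadPartial, ih fun j hj => h j (hj.trans k.le_succ),
      h k k.le_succ, h (k + 1) le_rfl]

theorem sub_le_spread_sub_rpow (hs0 : 0 < s) (hs1 : s < 1) {t u : ℝ} (htu : t < u)
    (h0 : B.leadingInt t 0 = B.leadingInt u 0) :
    u - t ≤ (4 * |B.spread u - B.spread t|) ^ s := by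
  have hsub : 0 < u - t := sub_pos.2 htu
  have hne : ∃ k, B.leadingInt t k ≠ B.leadingInt u k := by
    obtain ⟨k, hk⟩ := pow_unbounded_of_one_lt (1 / (u - t)) one_lt_two
    refine ⟨k, fun h => ?_⟩
    have h1 := Int.abs_sub_lt_one_of_floor_eq_floor h.symm
    rw [← mul_sub, abs_of_pos (by positivity)] at h1
    have h2 : (2 : ℝ) ^ k ≤ 2 ^ B.F k :=
      pow_le_pow_right₀ one_le_two (B.F_strictMono.le_apply)
    rw [div_lt_iff₀ hsub] at hk
    nlinarith
  classical
  obtain ⟨k, hk⟩ : ∃ k, Nat.find hne = k + 1 := by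
    refine Nat.exists_eq_succ_of_ne_zero fun h => ?_
    exact Nat.find_spec hne (h ▸ h0)
  have hdiff : B.leadingInt t (k + 1) ≠ B.leadingInt u (k + 1) := hk ▸ Nat.find_spec hne
  have hsame : ∀ j ≤ k, B.leadingInt t j = B.leadingInt u j := fun j hj => by
    by_contra h
    exact Nat.find_min hne (by omega) h
  have hG := B.spreadPartial_congr hsame
  have hle : B.leadingInt t (k + 1) ≤ B.leadingInt u (k + 1) :=
    Int.floor_mono (mul_le_mul_of_nonneg_left htu.le (by positivity))
  have hone : (B.leadingInt t (k + 1) : ℝ) + 1 ≤ B.leadingInt u (k + 1) := by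
    exact_mod_cast Int.add_one_le_of_lt (lt_of_le_of_ne hle hdiff)
  set Δ : ℝ := B.leadingInt u (k + 1) - B.leadingInt t (k + 1) with hΔ
  have hΔ1 : 1 ≤ Δ := by linarith
  have hgap : Δ / 2 ^ B.n (k + 1) / 2 ≤ B.spread u - B.spread t := by
    have h1 := (B.spread_mem_Icc u (k + 1)).1
    have h2 := (B.spread_mem_Icc t (k + 1)).2
    have h3 : B.spreadPartial u (k + 1) - B.spreadPartial t (k + 1)
        = Δ / 2 ^ B.n (k + 1) := by
      rw [spreadPartial, spreadPartial, hG, hsame k le_rfl, hΔ]; ring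
    have h4 : (1 : ℝ) / 2 ^ B.m (k + 1) ≤ 1 / 2 ^ B.n (k + 1) / 2 := by
      rw [div_div, ← pow_succ]
      gcongr
      · norm_num
      · exact B.n_lt_m k
    have h5 : (1 : ℝ) / 2 ^ B.n (k + 1) ≤ Δ / 2 ^ B.n (k + 1) := by gcongr
    linarith
  have hup1 : u - t ≤ 1 / 2 ^ B.F k := by
    have h1 := Int.abs_sub_lt_one_of_floor_eq_floor (hsame k le_rfl).symm
    rw [← mul_sub, abs_of_pos (by positivity)] at h1
    rw [le_div_iff₀' (by positivity)]; exact h1.le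
  have hup2 : u - t ≤ 4 * (B.spread u - B.spread t) * (2 ^ B.m k / 2 ^ B.F k) := by
    have h1 := Int.floor_le (2 ^ B.F (k + 1) * t)
    have h2 := Int.lt_floor_add_one (2 ^ B.F (k + 1) * u)
    have h3 : 2 ^ B.F (k + 1) * (u - t) ≤ 2 * Δ := by
      simp only [leadingInt] at hΔ
      rw [mul_sub]; linarith
    have e : (2 : ℝ) ^ B.n (k + 1) * 2 ^ B.F k = 2 ^ B.m k * 2 ^ B.F (k + 1) := by
      rw [← pow_add, ← pow_add, B.n_succ]
    have e' : (2 : ℝ) ^ B.m k / 2 ^ B.F k = 2 ^ B.n (k + 1) / 2 ^ B.F (k + 1) := by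
      rw [div_eq_div_iff (by positivity) (by positivity), e]
    calc u - t ≤ 2 * Δ / 2 ^ B.F (k + 1) := by rwa [le_div_iff₀' (by positivity)]
      _ = 4 * (Δ / 2 ^ B.n (k + 1) / 2) * (2 ^ B.n (k + 1) / 2 ^ B.F (k + 1)) := by
          field_simp; ring
      _ ≤ _ := by rw [e']; gcongr
  have hD : 0 ≤ 4 * (B.spread u - B.spread t) := by
    have : 0 ≤ Δ / 2 ^ B.n (k + 1) / 2 := by positivity
    linarith
  have hratio : ((2 : ℝ) ^ B.m k / 2 ^ B.F k) ^ s * (1 / 2 ^ B.F k) ^ (1 - s) ≤ 1 := by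
    have e1 : (2 : ℝ) ^ B.m k / 2 ^ B.F k = (2 : ℝ) ^ ((B.m k : ℝ) - B.F k) := by
      rw [Real.rpow_sub two_pos, Real.rpow_natCast, Real.rpow_natCast]
    have e2 : (1 : ℝ) / 2 ^ B.F k = (2 : ℝ) ^ (-(B.F k : ℝ)) := by
      rw [Real.rpow_neg two_pos.le, Real.rpow_natCast, one_div]
    rw [e1, e2, ← Real.rpow_mul two_pos.le, ← Real.rpow_mul two_pos.le,
      ← Real.rpow_add two_pos]
    refine Real.rpow_le_one_of_one_le_of_nonpos one_le_two ?_
    have := B.mul_m_le k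
    linarith
  calc u - t = (u - t) ^ s * (u - t) ^ (1 - s) := by
        rw [← Real.rpow_add hsub, add_sub_cancel, Real.rpow_one]
    _ ≤ (4 * (B.spread u - B.spread t) * (2 ^ B.m k / 2 ^ B.F k)) ^ s
          * (1 / 2 ^ B.F k) ^ (1 - s) := by
        gcongr
    _ = (4 * (B.spread u - B.spread t)) ^ s *
          ((2 ^ B.m k / 2 ^ B.F k) ^ s * (1 / 2 ^ B.F k) ^ (1 - s)) := by
        rw [Real.mul_rpow hD (by positivity), mul_assoc]
    _ ≤ (4 * (B.spread u - B.spread t)) ^ s :=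
        mul_le_of_le_one_right (Real.rpow_nonneg hD _) hratio
    _ ≤ _ := by gcongr; exact le_abs_self _

theorem hausdorffMeasure_carrier_ne_zero (hs0 : 0 < s) (hs1 : s < 1) :
    μH[s] B.carrier ≠ 0 := by
  set A : Set ℝ := Ico 0 (1 / 2 ^ B.F 0) with hA
  have hzero : ∀ t ∈ A, B.leadingInt t 0 = 0 := fun t ht => by
    rw [leadingInt, Int.floor_eq_zero_iff]
    refine ⟨mul_nonneg (by positivity) ht.1, ?_⟩
    have := ht.2
    rwa [lt_div_iff₀' (by positivity)] at this
  have hdist : ∀ t ∈ A, ∀ u ∈ A, |t - u| ≤ (4 * |B.spread t - B.spread u|) ^ s := by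
    have key : ∀ t ∈ A, ∀ u ∈ A, t < u → |t - u| ≤ (4 * |B.spread t - B.spread u|) ^ s := by
      intro t ht u hu htu
      rw [abs_sub_comm, abs_of_pos (sub_pos.2 htu), abs_sub_comm (B.spread t)]
      exact B.sub_le_spread_sub_rpow hs0 hs1 htu ((hzero t ht).trans (hzero u hu).symm)
    intro t ht u hu
    rcases lt_trichotomy t u with h | rfl | h
    · exact key t ht u hu h
    · simp [Real.zero_rpow hs0.ne']
    · rw [abs_sub_comm, abs_sub_comm (B.spread t)]; exact key u hu t ht h
  have hinj : InjOn B.spread A := fun t ht u hu h => by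
    have := hdist t ht u hu
    rw [h, sub_self, abs_zero, mul_zero, Real.zero_rpow hs0.ne'] at this
    exact sub_eq_zero.1 (abs_nonpos_iff.1 this)
  have hleft := hinj.leftInvOn_invFunOn
  have hholder : HolderOnWith (4 ^ s) s.toNNReal (Function.invFunOn B.spread A)
      (B.spread '' A) := by
    rintro _ ⟨t, ht, rfl⟩ _ ⟨u, hu, rfl⟩
    rw [hleft ht, hleft hu, edist_dist, edist_dist, ← ENNReal.ofReal_coe_nnreal,
      Real.coe_toNNReal s hs0.le, ENNReal.ofReal_rpow_of_nonneg dist_nonneg hs0.le,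
      ← ENNReal.ofReal_mul NNReal.zero_le_coe, Real.dist_eq, Real.dist_eq]
    refine ENNReal.ofReal_le_ofReal ((hdist t ht u hu).trans (le_of_eq ?_))
    rw [Real.mul_rpow (by norm_num) (abs_nonneg _)]
    simp
  have himage : Function.invFunOn B.spread A '' (B.spread '' A) = A := hleft.image_image
  have hle := hholder.hausdorffMeasure_image_le (Real.toNNReal_pos.2 hs0) zero_le_one
  have hvol : volume A = ENNReal.ofReal (1 / 2 ^ B.F 0) := by
    rw [hA, Real.volume_Ico, sub_zero]
  rw [himage, hausdorffMeasure_real, hvol] at hle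
  intro h0
  have hK : μH[s] (B.spread '' A) = 0 := by
    refine measure_mono_null ?_ h0
    rintro _ ⟨t, -, rfl⟩
    exact mem_iUnion.2 ⟨0, B.spread_mem_layer t⟩
  rw [mul_one, Real.coe_toNNReal s hs0.le, hK, mul_zero, nonpos_iff_eq_zero,
    ENNReal.ofReal_eq_zero] at hle
  exact absurd hle (not_le.2 (by positivity))

theorem hausdorffMeasure_carrier (hs0 : 0 < s) (hs1 : s < 1) : μH[s] B.carrier = ∞ := by
  by_contra htop
  have hne := B.hausdorffMeasure_carrier_ne_zero hs0 hs1
  have hsub : (fun x : ℝ => 2 * x) '' B.carrier ⊆ B.carrier := by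
    rintro _ ⟨x, hx, rfl⟩
    obtain ⟨C, hC⟩ := mem_iUnion.1 hx
    exact mem_iUnion.2 ⟨C + 1, B.two_mul_mem_layer hC⟩
  have h := measure_mono (μ := μH[s]) hsub
  have hsmul := Measure.hausdorffMeasure_smul₀ hs0.le (two_ne_zero (α := ℝ)) B.carrier
  rw [← image_smul] at hsmul
  simp only [smul_eq_mul] at hsmul
  rw [hsmul, ENNReal.smul_def, smul_eq_mul] at h
  have htwo : (1 : ℝ≥0∞) < ((‖(2 : ℝ)‖₊ ^ s : NNReal) : ℝ≥0∞) := by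
    rw [Real.nnnorm_two]
    exact_mod_cast NNReal.one_lt_rpow one_lt_two hs0
  refine (ENNReal.mul_lt_mul_left hne htop htwo).not_ge ?_
  rwa [one_mul]

end DigitBlocks

theorem exists_midpointConvex_not_convex_hausdorffMeasure_infty_dim_s
    (s : ℝ) (hs0 : 0 < s) (hs1 : s < 1) :
    ∃ E : Set ℝ, MeasurableSet E ∧ dimH E = ENNReal.ofReal s ∧
      (∀ x ∈ E, ∀ y ∈ E, (x + y) / 2 ∈ E) ∧ ¬ Convex ℝ E ∧
      μH[s] E = ∞ := by
  obtain ⟨B⟩ := nonempty_digitBlocks hs0 hs1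
  have htop := B.hausdorffMeasure_carrier hs0 hs1
  have hdim : dimH B.carrier = ENNReal.ofReal s := by
    refine le_antisymm (B.dimH_carrier_le hs0) ?_
    refine le_dimH_of_hausdorffMeasure_eq_top ?_
    rwa [Real.coe_toNNReal _ hs0.le]
  refine ⟨B.carrier, B.measurableSet_carrier, hdim,
    fun x hx y hy => B.midpoint_mem_carrier hx hy, fun hconv => ?_, htop⟩
  have hne : B.carrier.Nonempty := by
    refine nonempty_iff_ne_empty.2 fun h => ?_
    simp [h] at htop
  have h := Real.Convex.dimH_eq_finrank_vectorSpan hconv hne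
  rw [hdim] at h
  have h' : s = (Module.finrank ℝ (vectorSpan ℝ B.carrier) : ℕ) := by
    rw [← ENNReal.ofReal_natCast] at h
    exact (ENNReal.ofReal_eq_ofReal_iff hs0.le (Nat.cast_nonneg _)).1 h
  rw [h'] at hs0 hs1
  norm_cast at hs0 hs1
  omega
end

section
/- Let E ⊆ ℝ be a Lebesgue measurable set that is mid-point convex and has positive Lebesgue measure. Then E is convex. -/
open MeasureTheory Set Filter

open scoped Topology

/-- The set of sums of a measurable set of positive measure with itself is a neighbourhood of some
point. -/
lemma exists_setOf_add_mem_nhds {A : Set ℝ} (hA : MeasurableSet A) (hpos : 0 < volume A) :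
    ∃ c : ℝ, {s | ∃ x ∈ A, ∃ y ∈ A, x + y = s} ∈ 𝓝 c := by
  set S : Set (ℝ × ℝ) := {z | z.2 ∈ A ∧ z.1 - z.2 ∈ A} with hS
  have hSm : MeasurableSet S :=
    (measurable_snd hA).inter ((measurable_fst.sub measurable_snd) hA)
  have hmp := (Measure.measurePreserving_swap (μ := (volume : Measure ℝ))
    (ν := (volume : Measure ℝ))).comp
    (measurePreserving_prod_add (volume : Measure ℝ) (volume : Measure ℝ))
  have hpre : (Prod.swap ∘ fun z : ℝ × ℝ => (z.1, z.1 + z.2)) ⁻¹' S = A ×ˢ A := by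
    ext ⟨x, y⟩
    simp [hS]
  have hvol : (volume.prod volume) S = volume A * volume A := by
    rw [← hmp.measure_preimage hSm.nullMeasurableSet, hpre, Measure.prod_prod]
  obtain ⟨c, hc⟩ : ∃ c : ℝ, volume (Prod.mk c ⁻¹' S) ≠ 0 := by
    by_contra! h
    have h0 := (Measure.measure_prod_null (μ := volume) hSm).2 (Eventually.of_forall h)
    rw [hvol] at h0
    exact (mul_ne_zero hpos.ne' hpos.ne') h0
  have hnhds := Measure.sub_mem_nhds_zero_of_addHaar_pos volume (Prod.mk c ⁻¹' S)
    (measurable_prodMk_left hSm) (pos_iff_ne_zero.2 hc)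
  refine ⟨c, ?_⟩
  have hcont : Tendsto (fun s : ℝ => s - c) (𝓝 c) (𝓝 0) := by
    have : ContinuousAt (fun s : ℝ => s - c) c := by fun_prop
    simpa [ContinuousAt] using this
  filter_upwards [hcont hnhds] with s hs
  obtain ⟨x, hx, y, hy, hxy⟩ := hs
  refine ⟨x, hx.1, c - y, hy.2, ?_⟩
  simp only at hxy
  linarith

/-- A closed set of reals that is closed under midpoints is order-connected. -/
lemma IsClosed.ordConnected_of_midpoint_mem {C : Set ℝ} (hC : IsClosed C)
    (hmid : ∀ x ∈ C, ∀ y ∈ C, (x + y) / 2 ∈ C) : C.OrdConnected := by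
  refine ⟨fun a ha b hb z hz => ?_⟩
  obtain ⟨l, ⟨hlC, hl⟩, hlmax⟩ :=
    (isCompact_Icc.inter_left hC : IsCompact (C ∩ Icc a z)).exists_isGreatest
      ⟨a, ha, le_rfl, hz.1⟩
  obtain ⟨r, ⟨hrC, hr⟩, hrmin⟩ :=
    (isCompact_Icc.inter_left hC : IsCompact (C ∩ Icc z b)).exists_isLeast
      ⟨b, hb, hz.2, le_rfl⟩
  have hm := hmid l hlC r hrC
  rcases le_total ((l + r) / 2) z with h | h
  · have := hlmax ⟨hm, by linarith [hl.1, hl.2, hr.1], h⟩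
    have : l = z := by linarith [hl.2, hr.1]
    exact this ▸ hlC
  · have := hrmin ⟨hm, h, by linarith [hl.2, hr.1, hr.2]⟩
    have : r = z := by linarith [hl.2, hr.1]
    exact this ▸ hrC

lemma closure_midpoint_mem {E : Set ℝ} (hmid : ∀ x ∈ E, ∀ y ∈ E, (x + y) / 2 ∈ E) :
    ∀ x ∈ closure E, ∀ y ∈ closure E, (x + y) / 2 ∈ closure E :=
  fun _ hx _ hy => map_mem_closure₂ (f := fun x y : ℝ => (x + y) / 2) (by fun_prop) hx hy hmid

lemma combo_half_pow_mem {E : Set ℝ} (hmid : ∀ x ∈ E, ∀ y ∈ E, (x + y) / 2 ∈ E)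
    {d u : ℝ} (hd : d ∈ E) (hu : u ∈ E) (n : ℕ) :
    (1 - (1 / 2 : ℝ) ^ n) * d + (1 / 2 : ℝ) ^ n * u ∈ E := by
  induction n with
  | zero => simpa using hu
  | succ n ih =>
    convert hmid d hd _ ih using 1
    ring

/-- A set of reals that is closed under midpoints and has nonempty interior is order-connected. -/
lemma ordConnected_of_midpoint_mem_of_mem_nhds {E : Set ℝ}
    (hmid : ∀ x ∈ E, ∀ y ∈ E, (x + y) / 2 ∈ E) {p : ℝ} (hp : E ∈ 𝓝 p) : E.OrdConnected := by
  refine ⟨fun a ha b hb z hz => ?_⟩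
  rcases hz.1.eq_or_lt with rfl | haz
  · exact ha
  rcases hz.2.eq_or_lt with rfl | hzb
  · exact hb
  have hq : Tendsto (fun n : ℕ => (1 / 2 : ℝ) ^ n) atTop (𝓝 0) :=
    tendsto_pow_atTop_nhds_zero_of_lt_one (by norm_num) (by norm_num)
  have hlim : Tendsto (fun q : ℝ => (z - q * p) / (1 - q)) (𝓝 0) (𝓝 z) := by
    have : ContinuousAt (fun q : ℝ => (z - q * p) / (1 - q)) 0 := by
      fun_prop (disch := norm_num)
    simpa [ContinuousAt] using this
  obtain ⟨n, hn, hn1⟩ := (((hlim.comp hq).eventually (Ioo_mem_nhds haz hzb)).and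
    (hq.eventually (gt_mem_nhds one_pos))).exists
  have hcomb := fun d hd u hu => combo_half_pow_mem hmid (d := d) (u := u) hd hu n
  have hq0 : (0 : ℝ) < (1 / 2 : ℝ) ^ n := by positivity
  simp only [Function.comp_apply] at hn
  generalize (1 / 2 : ℝ) ^ n = q at *
  have hq1 : 1 - q ≠ 0 := by linarith
  have hd₀ : (z - q * p) / (1 - q) ∈ closure E :=
    (isClosed_closure.ordConnected_of_midpoint_mem (closure_midpoint_mem hmid)).out
      (subset_closure ha) (subset_closure hb) (Ioo_subset_Icc_self hn)
  have hg : Tendsto (fun d => (z - (1 - q) * d) / q) (𝓝 ((z - q * p) / (1 - q))) (𝓝 p) := by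
    have : ContinuousAt (fun d => (z - (1 - q) * d) / q) ((z - q * p) / (1 - q)) := by fun_prop
    convert this.tendsto using 2
    field_simp
    ring
  obtain ⟨d, hdu, hd⟩ := mem_closure_iff_nhds.1 hd₀ _ (hg hp)
  convert hcomb d hd _ hdu using 1
  field_simp
  ring

theorem convex_of_midpointConvex_of_pos_measure
    (E : Set ℝ) (hE : NullMeasurableSet E volume)
    (hpos : 0 < volume E)
    (hmid : ∀ x ∈ E, ∀ y ∈ E, (x + y) / 2 ∈ E) :
    Convex ℝ E := by
  obtain ⟨A, hAE, hA, hAeq⟩ := hE.exists_measurable_subset_ae_eq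
  obtain ⟨c, hc⟩ := exists_setOf_add_mem_nhds hA (measure_congr hAeq ▸ hpos)
  have hlim : Tendsto (fun s : ℝ => 2 * s) (𝓝 (c / 2)) (𝓝 c) := by
    have : ContinuousAt (fun s : ℝ => 2 * s) (c / 2) := by fun_prop
    convert this.tendsto using 2
    ring
  refine (ordConnected_of_midpoint_mem_of_mem_nhds hmid (p := c / 2) ?_).convex
  filter_upwards [hlim hc] with s hs
  obtain ⟨x, hx, y, hy, hxy⟩ := hs
  convert hmid x (hAE hx) y (hAE hy) using 1
  linarith
end

section
/- Let 0 < s₀ ≤ 1 and let E ⊆ [0,1) be a Borel set that is mid-point convex but not convex, with dim_H(E) = s₀ and H^{s₀}(E) = 0. Let d₀ ≥ 1 be an integer. Then the set F = E × [0,1)^{d₀} ⊆ ℝ^{1+d₀} satisfies dim_H(F) = s₀ + d₀, H^{s₀+d₀}(F) = 0, F is mid-point convex, and F is not essentially convex. -/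
open MeasureTheory Set Metric Filter
open scoped ENNReal

/-- A set `E ⊆ ℝ^d` is mid-point convex if the midpoint of any two of its points
belongs to it. -/
def MidpointConvexSet {d : ℕ} (E : Set (EuclideanSpace ℝ (Fin d))) : Prop :=
  ∀ x ∈ E, ∀ y ∈ E, midpoint ℝ x y ∈ E

/-- A set `E ⊆ ℝ^d` is essentially convex if there are an integer `1 ≤ s ≤ d` and an affine
subspace `L` of dimension `s` containing `E` such that, in the subspace topology of `L`,
`E` has nonempty interior and `convexHull E \ E` lies in the frontier of `convexHull E`. -/
def EssentiallyConvex {d : ℕ} (E : Set (EuclideanSpace ℝ (Fin d))) : Prop :=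
  ∃ s : ℕ, 1 ≤ s ∧ s ≤ d ∧
    ∃ L : AffineSubspace ℝ (EuclideanSpace ℝ (Fin d)),
      Module.finrank ℝ L.direction = s ∧
      E ⊆ (L : Set (EuclideanSpace ℝ (Fin d))) ∧
      (interior ((Subtype.val : L → EuclideanSpace ℝ (Fin d)) ⁻¹' E)).Nonempty ∧
      (Subtype.val : L → EuclideanSpace ℝ (Fin d)) ⁻¹' (convexHull ℝ E \ E) ⊆
        frontier ((Subtype.val : L → EuclideanSpace ℝ (Fin d)) ⁻¹' (convexHull ℝ E))

/-- Slicing a cover of `A ×ˢ Q` and integrating over `Q` bounds the Hausdorff measure of a product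
with a subset of `ℝ^ι` from below. -/
theorem hausdorffMeasure_mul_volume_le_prod {X ι : Type*} [EMetricSpace X] [MeasurableSpace X]
    [BorelSpace X] [Fintype ι] {s : ℝ} (hs : 0 ≤ s) (A : Set X) {Q : Set (ι → ℝ)}
    (hQ : MeasurableSet Q) :
    μH[s] A * volume Q ≤ μH[s + Fintype.card ι] (A ×ˢ Q) := by
  simp only [Measure.hausdorffMeasure_apply, ENNReal.iSup_mul]
  refine iSup₂_mono fun r _ => ?_
  refine le_iInf₂ fun t ht => le_iInf fun htr => ?_
  set P : ℕ → Set (ι → ℝ) := fun n => toMeasurable volume (Prod.snd '' t n) with hP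
  set I := ⨅ (t : ℕ → Set X) (_ : A ⊆ ⋃ n, t n) (_ : ∀ n, ediam (t n) ≤ r),
    ∑' n, ⨆ _ : (t n).Nonempty, ediam (t n) ^ s
  have slice (x : ι → ℝ) (hx : x ∈ Q) :
      I ≤ ∑' n, (P n).indicator (fun _ => ediam (t n) ^ s) x := by
    have hdiam (n : ℕ) : ediam {e | (e, x) ∈ t n} ≤ ediam (t n) :=
      ediam_le fun a ha b hb => by
        simpa [Prod.edist_eq] using edist_le_ediam_of_mem (s := t n) ha hb
    refine (iInf₂_le_of_le (fun n => {e | (e, x) ∈ t n}) ?_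
      (iInf_le_of_le (fun n => (hdiam n).trans (htr n)) le_rfl)).trans ?_
    · intro e he
      simpa using ht (mk_mem_prod he hx)
    · refine ENNReal.tsum_le_tsum fun n => iSup_le fun ⟨e, he⟩ => ?_
      have : x ∈ P n := subset_toMeasurable _ _ ⟨(e, x), he, rfl⟩
      rw [indicator_of_mem this]
      exact ENNReal.rpow_le_rpow (hdiam n) hs
  calc I * volume Q = ∫⁻ _ in Q, I := by simp
    _ ≤ ∫⁻ x in Q, ∑' n, (P n).indicator (fun _ => ediam (t n) ^ s) x :=
      setLIntegral_mono' hQ slice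
    _ ≤ ∫⁻ x, ∑' n, (P n).indicator (fun _ => ediam (t n) ^ s) x := setLIntegral_le_lintegral _ _
    _ = ∑' n, ediam (t n) ^ s * volume (P n) := by
      rw [lintegral_tsum fun n =>
        (measurable_const.indicator (measurableSet_toMeasurable _ _)).aemeasurable]
      exact tsum_congr fun n => lintegral_indicator_const (measurableSet_toMeasurable _ _) _
    _ ≤ _ := ENNReal.tsum_le_tsum fun n => by
      rcases (t n).eq_empty_or_nonempty with h | h
      · simp [hP, h]
      · simp only [h, iSup_pos, hP, measure_toMeasurable]
        rw [ENNReal.rpow_add_of_nonneg _ _ hs (by positivity), ENNReal.rpow_natCast]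
        gcongr
        refine (Real.volume_pi_le_diam_pow _).trans ?_
        gcongr
        simpa using (LipschitzWith.prod_snd (α := X) (β := ι → ℝ)).ediam_image_le (t n)

/-- A set of Hausdorff measure zero is covered by sets of positive size with arbitrarily small
total weight. -/
theorem exists_cover_of_hausdorffMeasure_eq_zero {X : Type*} [EMetricSpace X] [MeasurableSpace X]
    [BorelSpace X] {s : ℝ} (hs : 0 < s) {A : Set X} (hA : μH[s] A = 0) {ε : ℝ≥0∞} (hε : ε ≠ 0) :
    ∃ (T : ℕ → Set X) (ρ : ℕ → ℝ≥0∞), A ⊆ ⋃ n, T n ∧ (∀ n, ediam (T n) ≤ ρ n) ∧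
      (∀ n, 0 < ρ n) ∧ (∀ n, ρ n ≤ ε) ∧ ∑' n, ρ n ^ s ≤ ε := by
  set δ := min ε (ε ^ s)
  have hδ : δ ≠ 0 := by
    have : 0 < ε ^ s := ENNReal.rpow_pos_of_nonneg (pos_iff_ne_zero.2 hε) hs.le
    exact (lt_min (pos_iff_ne_zero.2 hε) this).ne'
  have hδ2 : δ / 2 ≠ 0 := by simpa using hδ
  have hlt : (⨅ (t : ℕ → Set X) (_ : A ⊆ ⋃ n, t n) (_ : ∀ n, ediam (t n) ≤ ⊤),
      ∑' n, ⨆ _ : (t n).Nonempty, ediam (t n) ^ s) < δ / 2 := by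
    refine lt_of_le_of_lt ?_ (pos_iff_ne_zero.2 hδ2)
    rw [← hA, Measure.hausdorffMeasure_apply]
    exact le_iSup₂_of_le ⊤ ENNReal.zero_lt_top le_rfl
  simp only [iInf_lt_iff] at hlt
  obtain ⟨T, hT, -, hsum⟩ := hlt
  obtain ⟨η, hη, hηsum⟩ := ENNReal.exists_pos_sum_of_countable hδ2 ℕ
  set ρ : ℕ → ℝ≥0∞ := fun n => max (ediam (T n)) ((η n : ℝ≥0∞) ^ s⁻¹) with hρ
  have hρs : ∑' n, ρ n ^ s ≤ δ := by
    calc ∑' n, ρ n ^ s ≤ ∑' n, ((⨆ _ : (T n).Nonempty, ediam (T n) ^ s) + η n) := by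
          refine ENNReal.tsum_le_tsum fun n => ?_
          rcases max_cases (ediam (T n)) ((η n : ℝ≥0∞) ^ s⁻¹) with ⟨h, -⟩ | ⟨h, -⟩
          · simp only [hρ, h]
            rcases (T n).eq_empty_or_nonempty with h' | h'
            · simp [h', hs]
            · simp [h']
          · simp only [hρ, h]
            rw [ENNReal.rpow_inv_rpow hs.ne']
            exact le_add_self
      _ ≤ δ / 2 + δ / 2 := by
          rw [ENNReal.tsum_add]
          exact add_le_add hsum.le hηsum.le
      _ = δ := ENNReal.add_halves _
  refine ⟨T, ρ, hT, fun n => le_max_left _ _, fun n => lt_max_of_lt_right ?_, fun n => ?_,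
    hρs.trans (min_le_left _ _)⟩
  · exact ENNReal.rpow_pos (by exact_mod_cast hη n) ENNReal.coe_ne_top
  · exact (ENNReal.rpow_le_rpow_iff hs).1
      ((ENNReal.le_tsum n).trans (hρs.trans (min_le_right _ _)))

/-- The unit cube is covered by `k ^ card ι` cubes of side `1 / k ≤ ρ`, where `k ρ ≤ 2`. -/
theorem exists_cover_unitCube (ι : Type*) [Fintype ι] {ρ : ℝ≥0∞} (h0 : 0 < ρ) (h1 : ρ ≤ 1) :
    ∃ (k : ℕ) (C : (ι → Fin k) → Set (ι → ℝ)), k * ρ ≤ 2 ∧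
      (univ.pi fun _ : ι => Ico (0 : ℝ) 1) ⊆ ⋃ j, C j ∧ ∀ j, ediam (C j) ≤ ρ := by
  lift ρ to NNReal using (h1.trans_lt ENNReal.one_lt_top).ne
  have h0' : 0 < (ρ : ℝ) := by exact_mod_cast h0
  have h1' : (ρ : ℝ) ≤ 1 := by exact_mod_cast h1
  set k := ⌈(ρ : ℝ)⁻¹⌉₊
  have hk : (0 : ℝ) < k := by
    have : 0 < k := Nat.ceil_pos.2 (by positivity)
    exact_mod_cast this
  have hkρ : (k : ℝ)⁻¹ ≤ ρ := inv_le_of_inv_le₀ h0' (Nat.le_ceil _)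
  refine ⟨k, fun j => univ.pi fun i => Icc ((j i : ℝ) / k) ((j i : ℝ) / k + (k : ℝ)⁻¹),
    ?_, ?_, fun j => ediam_pi_le_of_le fun i => ?_⟩
  · have h : (k : ℝ) * ρ ≤ 2 := by
      have := (Nat.ceil_lt_add_one (inv_nonneg.2 h0'.le)).le
      calc (k : ℝ) * ρ ≤ ((ρ : ℝ)⁻¹ + 1) * ρ := by gcongr
        _ = 1 + ρ := by field_simp
        _ ≤ 2 := by linarith
    exact_mod_cast h
  · intro y hy
    simp only [Set.mem_pi, mem_univ, true_imp_iff, mem_Ico] at hy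
    have hyk (i : ι) : 0 ≤ y i * k := mul_nonneg (hy i).1 hk.le
    refine mem_iUnion.2 ⟨fun i => ⟨⌊y i * k⌋₊, ?_⟩, fun i _ => ⟨?_, ?_⟩⟩
    · rw [Nat.floor_lt (hyk i)]
      nlinarith [(hy i).2]
    · rw [div_le_iff₀ hk]
      exact Nat.floor_le (hyk i)
    · rw [← one_div, ← add_div, le_div_iff₀ hk]
      exact (Nat.lt_floor_add_one _).le
  · rw [Real.ediam_Icc, add_sub_cancel_left]
    exact ENNReal.ofReal_le_of_le_toReal (by simpa using hkρ)

theorem hausdorffMeasure_prod_unitCube_eq_zero {X ι : Type*} [EMetricSpace X] [MeasurableSpace X]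
    [BorelSpace X] [Fintype ι] {s : ℝ} (hs : 0 < s) {A : Set X} (hA : μH[s] A = 0) :
    μH[s + Fintype.card ι] (A ×ˢ (univ.pi fun _ : ι => Ico (0 : ℝ) 1)) = 0 := by
  set ε : ℕ → ℝ≥0∞ := fun n => ((n + 1 : ℕ) : ℝ≥0∞)⁻¹ with hε
  have hεt : Tendsto ε atTop (nhds 0) :=
    ENNReal.tendsto_inv_nat_nhds_zero.comp (tendsto_add_atTop_nat 1)
  have hε0 (n : ℕ) : ε n ≠ 0 := by simp [hε]
  have hε1 (n : ℕ) : ε n ≤ 1 := by simp [hε]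
  choose T ρ hT hTd h0 hle hsum using
    fun n => exists_cover_of_hausdorffMeasure_eq_zero hs hA (hε0 n)
  choose k C hk hC hCd using
    fun n m => exists_cover_unitCube ι (h0 n m) ((hle n m).trans (hε1 n))
  have hdiam (n : ℕ) (p : Σ m, ι → Fin (k n m)) :
      ediam (T n p.1 ×ˢ C n p.1 p.2) ≤ ρ n p.1 :=
    ediam_le fun a ha b hb => max_le
      (edist_le_of_ediam_le ha.1 hb.1 (hTd n p.1))
      (edist_le_of_ediam_le ha.2 hb.2 (hCd n p.1 p.2))
  have hbound (n : ℕ) : ∑' p : Σ m, ι → Fin (k n m),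
      ediam (T n p.1 ×ˢ C n p.1 p.2) ^ (s + Fintype.card ι) ≤ 2 ^ Fintype.card ι * ε n :=
    calc _ ≤ ∑' p : Σ m, ι → Fin (k n m), ρ n p.1 ^ (s + Fintype.card ι) :=
          ENNReal.tsum_le_tsum fun p => ENNReal.rpow_le_rpow (hdiam n p) (by positivity)
      _ = ∑' m, (k n m * ρ n m) ^ Fintype.card ι * ρ n m ^ s := by
          rw [ENNReal.tsum_sigma']
          refine tsum_congr fun m => ?_
          simp only [ENNReal.rpow_add_of_nonneg _ _ hs.le (Nat.cast_nonneg (Fintype.card ι)),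
            ENNReal.rpow_natCast]
          simp [mul_pow, mul_assoc, mul_comm (ρ n m ^ s)]
      _ ≤ ∑' m, 2 ^ Fintype.card ι * ρ n m ^ s := ENNReal.tsum_le_tsum fun m => by
          gcongr
          exact hk n m
      _ ≤ _ := by
          rw [ENNReal.tsum_mul_left]
          gcongr
          exact hsum n
  refine le_antisymm ((Measure.hausdorffMeasure_le_liminf_tsum
    (ι := fun n => Σ m, ι → Fin (k n m)) _ _ ε hεt (fun n p => T n p.1 ×ˢ C n p.1 p.2)
    (.of_forall fun n p => (hdiam n p).trans (hle n p.1)) (.of_forall fun n => ?_)).trans ?_)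
    zero_le
  · rintro ⟨a, y⟩ ⟨ha, hy⟩
    obtain ⟨m, hm⟩ := mem_iUnion.1 (hT n ha)
    obtain ⟨j, hj⟩ := mem_iUnion.1 (hC n m hy)
    exact mem_iUnion.2 ⟨⟨m, j⟩, hm, hj⟩
  · refine (liminf_le_liminf (.of_forall hbound)).trans_eq ?_
    have : Tendsto (fun n => 2 ^ Fintype.card ι * ε n) atTop (nhds (2 ^ Fintype.card ι * 0)) :=
      ENNReal.Tendsto.const_mul hεt (Or.inr (by simp))
    rw [this.liminf_eq, mul_zero]

theorem dimH_add_card_le_dimH_prod {X ι : Type*} [EMetricSpace X] [Fintype ι] {A : Set X}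
    (hA : 0 < dimH A) {Q : Set (ι → ℝ)} (hQ : MeasurableSet Q) (hQ0 : volume Q ≠ 0) :
    dimH A + Fintype.card ι ≤ dimH (A ×ˢ Q) := by
  borelize X
  have key (c : NNReal) (hc : c < dimH A) : (c : ℝ≥0∞) + Fintype.card ι ≤ dimH (A ×ˢ Q) := by
    have h := hausdorffMeasure_mul_volume_le_prod c.coe_nonneg A hQ
    rw [hausdorffMeasure_of_lt_dimH hc, ENNReal.top_mul hQ0, top_le_iff] at h
    exact_mod_cast le_dimH_of_hausdorffMeasure_eq_top (d := c + Fintype.card ι)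
      (by exact_mod_cast h)
  have hcard : (Fintype.card ι : ℝ≥0∞) ≤ dimH (A ×ˢ Q) := by simpa using key 0 (by simpa using hA)
  exact add_le_of_le_tsub_right_of_le hcard <| ENNReal.le_of_forall_nnreal_lt fun c hc =>
    ENNReal.le_sub_of_add_le_right (by simp) (key c hc)

/-- Splitting off the first coordinate of a Euclidean space. -/
noncomputable def euclideanSplitFirst (d : ℕ) :
    EuclideanSpace ℝ (Fin (1 + d)) ≃L[ℝ] ℝ × (Fin d → ℝ) :=
  LinearEquiv.toContinuousLinearEquiv
    { toFun := fun x => (x (Fin.castAdd d 0), fun i => x (Fin.natAdd 1 i))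
      invFun := fun p => WithLp.toLp 2 (Fin.append (fun _ : Fin 1 => p.1) p.2)
      map_add' := fun _ _ => rfl
      map_smul' := fun _ _ => rfl
      left_inv := fun x => by
        ext i
        refine Fin.addCases (fun j => ?_) (fun j => ?_) i
        · simp [Subsingleton.elim j 0]
        · simp
      right_inv := fun p => by ext <;> simp }

@[simp]
theorem euclideanSplitFirst_apply (d : ℕ) (x : EuclideanSpace ℝ (Fin (1 + d))) :
    euclideanSplitFirst d x = (x (Fin.castAdd d 0), fun i => x (Fin.natAdd 1 i)) :=
  rfl

theorem midpointConvexSet_preimage_prod {d : ℕ} {V W : Type*} [AddCommGroup V]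
    [Module ℝ V] [AddCommGroup W] [Module ℝ W] (f : EuclideanSpace ℝ (Fin d) →ₗ[ℝ] V × W)
    {A : Set V} {Q : Set W} (hA : ∀ x ∈ A, ∀ y ∈ A, midpoint ℝ x y ∈ A) (hQ : Convex ℝ Q) :
    MidpointConvexSet (f ⁻¹' (A ×ˢ Q)) := by
  intro x hx y hy
  have h := f.toAffineMap.map_midpoint x y
  simp only [LinearMap.coe_toAffineMap] at h
  rw [mem_preimage, h]
  have h1 := (LinearMap.fst ℝ V W).toAffineMap.map_midpoint (f x) (f y)
  have h2 := (LinearMap.snd ℝ V W).toAffineMap.map_midpoint (f x) (f y)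
  simp only [LinearMap.coe_toAffineMap, LinearMap.fst_apply, LinearMap.snd_apply] at h1 h2
  exact ⟨h1 ▸ hA _ hx.1 _ hy.1, h2 ▸ hQ.midpoint_mem hx.2 hy.2⟩

/-- If the convex hull of `F` is a neighbourhood of a point outside `F`, then `F` is not
essentially convex. -/
theorem not_essentiallyConvex_of_mem_interior_convexHull {d : ℕ}
    {F : Set (EuclideanSpace ℝ (Fin d))} {p : EuclideanSpace ℝ (Fin d)}
    (hp : p ∈ interior (convexHull ℝ F)) (hpF : p ∉ F) : ¬ EssentiallyConvex F := by
  rintro ⟨-, -, -, L, -, hFL, -, hfr⟩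
  have hpL : p ∈ L := convexHull_min hFL L.convex (interior_subset hp)
  have hfrontier := hfr (a := ⟨p, hpL⟩) ⟨interior_subset hp, hpF⟩
  exact hfrontier.2 (preimage_interior_subset_interior_preimage continuous_subtype_val hp)

theorem Ioo_prod_subset_convexHull {W : Type*} [AddCommGroup W] [Module ℝ W] {A : Set ℝ}
    {a b : ℝ} (ha : a ∈ A) (hb : b ∈ A) (Q : Set W) :
    Ioo a b ×ˢ Q ⊆ convexHull ℝ (A ×ˢ Q) := by
  rintro ⟨x, y⟩ ⟨hx, hy⟩
  rw [convexHull_prod]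
  refine ⟨?_, subset_convexHull _ _ hy⟩
  exact (convex_convexHull ℝ A).ordConnected.out (subset_convexHull _ _ ha)
    (subset_convexHull _ _ hb) (Ioo_subset_Icc_self hx)

theorem product_with_cube_midpointConvex_not_essentiallyConvex
    (s₀ : ℝ) (hs0 : 0 < s₀) (hs1 : s₀ ≤ 1)
    (E : Set ℝ) (hEsub : E ⊆ Ico (0 : ℝ) 1) (hE : MeasurableSet E)
    (hmid : ∀ x ∈ E, ∀ y ∈ E, (x + y) / 2 ∈ E) (hnc : ¬ Convex ℝ E)
    (hdim : dimH E = ENNReal.ofReal s₀) (hmeas : μH[s₀] E = 0)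
    (d₀ : ℕ) (hd₀ : 1 ≤ d₀)
    (F : Set (EuclideanSpace ℝ (Fin (1 + d₀))))
    (hF : F = {x : EuclideanSpace ℝ (Fin (1 + d₀)) |
      x ⟨0, by omega⟩ ∈ E ∧ ∀ i : Fin (1 + d₀), i ≠ ⟨0, by omega⟩ → x i ∈ Ico (0 : ℝ) 1}) :
    dimH F = ENNReal.ofReal (s₀ + d₀) ∧ μH[s₀ + (d₀ : ℝ)] F = 0 ∧
      MidpointConvexSet F ∧ ¬ EssentiallyConvex F := by
  set Q : Set (Fin d₀ → ℝ) := univ.pi fun _ => Ico (0 : ℝ) 1 with hQ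
  set e := euclideanSplitFirst d₀ with he
  have hF' : F = e ⁻¹' (E ×ˢ Q) := by
    ext x
    rw [hF]
    refine and_congr Iff.rfl ⟨fun h i _ => h _ ?_, fun h i => ?_⟩
    · rw [Ne, Fin.ext_iff, Fin.val_natAdd]
      exact Nat.ne_of_gt (Nat.add_pos_left Nat.one_pos _)
    · refine Fin.addCases (fun j hj => ?_) (fun j _ => h j trivial) i
      exact absurd (Fin.ext (Nat.lt_one_iff.1 j.2)) hj
  have hzero : μH[s₀ + (d₀ : ℝ)] (E ×ˢ Q) = 0 := by
    simpa using hausdorffMeasure_prod_unitCube_eq_zero (ι := Fin d₀) hs0 hmeas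
  have hsum : ENNReal.ofReal (s₀ + d₀) = ENNReal.ofReal s₀ + d₀ := by
    rw [ENNReal.ofReal_add hs0.le (by positivity), ENNReal.ofReal_natCast]
  refine ⟨?_, ?_, ?_, ?_⟩
  · rw [hF', e.dimH_preimage]
    apply le_antisymm
    · refine dimH_le_of_hausdorffMeasure_ne_top (d := (s₀ + d₀).toNNReal) ?_
      rw [Real.coe_toNNReal _ (by positivity), hzero]
      exact ENNReal.zero_ne_top
    · have hQm : MeasurableSet Q := .univ_pi fun _ => measurableSet_Ico
      have hQ1 : volume Q ≠ 0 := by simp [hQ, Real.volume_pi_Ico]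
      simpa [hsum, hdim] using dimH_add_card_le_dimH_prod (A := E) (by simpa [hdim]) hQm hQ1
  · rw [hF', ← e.image_symm_eq_preimage]
    have h := e.symm.lipschitz.hausdorffMeasure_image_le (d := s₀ + d₀) (by positivity) (E ×ˢ Q)
    rwa [hzero, mul_zero, nonpos_iff_eq_zero] at h
  · rw [hF']
    refine midpointConvexSet_preimage_prod e.toLinearMap (fun x hx y hy => ?_)
      (convex_pi fun _ _ => convex_Ico 0 1)
    simpa [midpoint_eq_smul_add, div_eq_inv_mul] using hmid x hx y hy
  · obtain ⟨a, ha, b, hb, c, hc, hcE⟩ : ∃ a ∈ E, ∃ b ∈ E, ∃ c ∈ Icc a b, c ∉ E := by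
      contrapose! hnc
      exact OrdConnected.convex ⟨fun a ha b hb c hc => hnc a ha b hb c hc⟩
    have hac : a < c := hc.1.lt_of_ne fun h => hcE (h ▸ ha)
    have hcb : c < b := hc.2.lt_of_ne fun h => hcE (h ▸ hb)
    set U : Set (ℝ × (Fin d₀ → ℝ)) := Ioo a b ×ˢ univ.pi fun _ => Ioo (0 : ℝ) 1 with hU
    have hUo : IsOpen U := isOpen_Ioo.prod (isOpen_set_pi finite_univ fun _ _ => isOpen_Ioo)
    have hUF : e ⁻¹' U ⊆ convexHull ℝ F := by
      rw [hF', ← e.image_symm_eq_preimage, ← e.image_symm_eq_preimage]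
      refine Subset.trans ?_ (e.symm.toLinearMap.image_convexHull _).subset
      refine image_mono (Subset.trans ?_ (Ioo_prod_subset_convexHull ha hb Q))
      exact prod_mono_right (pi_mono fun _ _ => Ioo_subset_Ico_self)
    refine not_essentiallyConvex_of_mem_interior_convexHull (p := e.symm (c, fun _ => 1 / 2))
      (interior_maximal hUF (hUo.preimage e.continuous) ?_) ?_
    · rw [mem_preimage, e.apply_symm_apply]
      exact ⟨⟨hac, hcb⟩, fun _ _ => by norm_num⟩
    · rw [hF', mem_preimage, e.apply_symm_apply]
      exact fun h => hcE h.1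
end
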